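/- arXiv:2511.10272 — 2 statements merged into one kernel-verified Lean document; each statement's English description precedes it below -/
import Mathlib

section
/- Let W, λ, C be real numbers with W ≥ 1 and λ ≤ W. Let S_F and S_B be nonempty finite sets, and for each set S_D (D ∈ {F, B}) let g_D, h_D, e_D be real-valued functions on S_D satisfying 0 ≤ e_D(n) ≤ g_D(n) for every n ∈ S_D. Define b_D(n) = g_D(n) + h_D(n) + (g_D(n) − e_D(n)) and b_{W_D}(n) = g_D(n) + W·h_D(n) + λ·(g_D(n) − e_D(n)). If (min_{n∈S_F} b_F(n) + min_{n∈S_B} b_B(n))/2 ≤ C, then (min_{n∈S_F} b_{W_F}(n) + min_{n∈S_B} b_{W_B}(n))/2 ≤ W·C. -/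
theorem wbae_aux {α : Type*} (W lam : ℝ) (hW : 1 ≤ W) (hlam : lam ≤ W)
    (S : Finset α) (hS : S.Nonempty) (g h e : α → ℝ)
    (h0 : ∀ n ∈ S, 0 ≤ e n ∧ e n ≤ g n) :
    S.inf' hS (fun n => g n + W * h n + lam * (g n - e n))
      ≤ W * S.inf' hS (fun n => g n + h n + (g n - e n)) := by
  obtain ⟨m, hm, hmin⟩ := S.exists_mem_eq_inf' hS (fun n => g n + h n + (g n - e n))
  rw [hmin]
  refine (Finset.inf'_le _ hm).trans ?_
  obtain ⟨h1, h2⟩ := h0 m hm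
  have h3 : 0 ≤ (W - 1) * g m := mul_nonneg (by linarith) (by linarith)
  have h4 : 0 ≤ (W - lam) * (g m - e m) := mul_nonneg (by linarith) (by linarith)
  linarith

theorem wbae_bounded_suboptimal
    {αF αB : Type*} (W lam C : ℝ) (hW : 1 ≤ W) (hlam : lam ≤ W)
    (SF : Finset αF) (SB : Finset αB) (hSF : SF.Nonempty) (hSB : SB.Nonempty)
    (gF hF eF : αF → ℝ) (gB hB eB : αB → ℝ)
    (hF0 : ∀ n ∈ SF, 0 ≤ eF n ∧ eF n ≤ gF n)
    (hB0 : ∀ n ∈ SB, 0 ≤ eB n ∧ eB n ≤ gB n)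
    (hLB : (SF.inf' hSF (fun n => gF n + hF n + (gF n - eF n))
            + SB.inf' hSB (fun n => gB n + hB n + (gB n - eB n))) / 2 ≤ C) :
    (SF.inf' hSF (fun n => gF n + W * hF n + lam * (gF n - eF n))
      + SB.inf' hSB (fun n => gB n + W * hB n + lam * (gB n - eB n))) / 2 ≤ W * C := by
  have h1 := wbae_aux W lam hW hlam SF hSF gF hF eF hF0
  have h2 := wbae_aux W lam hW hlam SB hSB gB hB eB hB0
  have h3 := mul_le_mul_of_nonneg_left hLB (by linarith : (0 : ℝ) ≤ W)
  linarith
end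

section
/- Let W be a real number with W ≥ 1, let S be a nonempty finite set, and let g, h be real-valued functions on S with g(n) ≥ 0 for every n ∈ S. Then min_{n∈S} (g(n) + W·h(n)) ≤ W·(min_{n∈S} (g(n) + h(n))). -/
theorem prWMin_le_W_mul_fMin
    {α : Type*} (W : ℝ) (hW : 1 ≤ W)
    (S : Finset α) (hS : S.Nonempty)
    (g h : α → ℝ) (hg : ∀ n ∈ S, 0 ≤ g n) :
    S.inf' hS (fun n => g n + W * h n) ≤ W * S.inf' hS (fun n => g n + h n) := by
  obtain ⟨m, hm, hmin⟩ := Finset.exists_mem_eq_inf' hS (fun n => g n + h n)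
  rw [hmin]
  refine (Finset.inf'_le (fun n => g n + W * h n) hm).trans ?_
  have h0 := hg m hm
  show g m + W * h m ≤ W * (g m + h m)
  nlinarith [mul_nonneg (sub_nonneg.mpr hW) h0]
end
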